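/- The map η : A₂(n) → Λ³H ⊕ S²H, determined on generators by η(Y[i;j;k]) = e_i ∧ e_j ∧ e_k for pairwise distinct colors i, j, k, by η(Y[(i,m);(i,n);j]) = ε_{mn}·(e_i ⊙ e_j) for colors i ≠ j and distinct labels m, n (where ε_{mn} is the sign of n − m), and by η(Y[(i,m);(i,n);(i,l)]) = ε_{mnl}·(e_i ⊙ e_i) (where ε_{mnl} is the signature of the permutation sending (1,2,3) to (m,n,l)), is a well-defined isomorphism of abelian groups. -/

import Mathlib

/-! Common setup: the abelian group `A₂(n)` of Y-diagrams.

A generator ("Y-diagram") is modelled as a function `g : Fin 3 → Fin n × Fin 3`,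
assigning to each of the three (cyclically ordered) vertices a color in `{1,…,n}`
(modelled as `Fin n`) and a label in `{1,2,3}` (modelled as `Fin 3`).
Vertices whose color is shared must carry distinct labels (otherwise the
generator is declared to be `0`); labels of vertices with a unique color are
irrelevant, and only the relative order of labels of same-colored vertices
matters (the "relabeling" identification).  `A₂(n)` is the quotient of the free
abelian group on these generators by: the degenerate generators, the cyclic
identification, the relabeling identification, and the relations (AS), (AS2),
(W). -/

/-- A Y-diagram generator: three cyclically ordered vertices, each with a color
in `Fin n` and a label in `Fin 3`. -/
abbrev YGen (n : ℕ) := Fin 3 → Fin n × Fin 3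

namespace YDiag

variable {n : ℕ}

/-- The color of the `p`-th vertex. -/
def color (g : YGen n) (p : Fin 3) : Fin n := (g p).1

/-- The label of the `p`-th vertex. -/
def lab (g : YGen n) (p : Fin 3) : Fin 3 := (g p).2

/-- The set of defining relations for `A₂(n)` inside the free abelian group on
Y-diagram generators. -/
def rels (n : ℕ) : Set (FreeAbelianGroup (YGen n)) :=
  -- degenerate generators: two distinct vertices with the same color and label
  {x | ∃ g : YGen n, (∃ p q : Fin 3, p ≠ q ∧ g p = g q) ∧ x = FreeAbelianGroup.of g} ∪
  -- invariance under cyclic permutation of the vertices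
  {x | ∃ g : YGen n, x = FreeAbelianGroup.of g - FreeAbelianGroup.of (fun p => g (p + 1))} ∪
  -- relabeling: only the relative order of labels of same-colored vertices matters
  {x | ∃ g g' : YGen n, (∀ p, color g p = color g' p) ∧
      (∀ p q, color g p = color g q → (lab g p < lab g q ↔ lab g' p < lab g' q)) ∧
      x = FreeAbelianGroup.of g - FreeAbelianGroup.of g'} ∪
  -- (AS) : Y[i;j;k] = -Y[j;i;k] for pairwise distinct colors
  {x | ∃ g : YGen n, (color g 0 ≠ color g 1 ∧ color g 1 ≠ color g 2 ∧ color g 0 ≠ color g 2) ∧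
      x = FreeAbelianGroup.of g + FreeAbelianGroup.of (g ∘ Equiv.swap 0 1)} ∪
  -- (AS2) : Y[(i,m);(i,n);x] = -Y[(i,n);(i,m);x] for distinct labels m ≠ n
  {x | ∃ g : YGen n, color g 0 = color g 1 ∧ lab g 0 ≠ lab g 1 ∧
      x = FreeAbelianGroup.of g + FreeAbelianGroup.of (g ∘ Equiv.swap 0 1)} ∪
  -- (W) : Y[(i,m);(i,n);j] = Y[(j,m);(j,n);i] for distinct colors i ≠ j
  {x | ∃ (i j : Fin n) (m nn l l' : Fin 3), i ≠ j ∧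
      x = FreeAbelianGroup.of ![(i, m), (i, nn), (j, l)] -
          FreeAbelianGroup.of ![(j, m), (j, nn), (i, l')]}

/-- The abelian group `A₂(n)`. -/
abbrev A2 (n : ℕ) :=
  FreeAbelianGroup (YGen n) ⧸ AddSubgroup.closure (rels n)

/-- The class in `A₂(n)` of a Y-diagram generator. -/
def cls (g : YGen n) : A2 n := QuotientAddGroup.mk (FreeAbelianGroup.of g)

/-- The number of distinct colors used by the vertices of a Y-diagram. -/
def numColors (g : YGen n) : ℕ := (Finset.univ.image (color g)).card

/-- The subgroup `A_{2,k}(n)` of `A₂(n)` generated by the classes of Y-diagrams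
using exactly `k` distinct colors. -/
def A2k (n k : ℕ) : AddSubgroup (A2 n) :=
  AddSubgroup.closure {x | ∃ g : YGen n, numColors g = k ∧ x = cls g}

end YDiag

open TensorProduct

/-- The relations `x ⊗ y = y ⊗ x` defining the second symmetric power of `ℤⁿ`. -/
noncomputable def symRel (n : ℕ) : Submodule ℤ ((Fin n → ℤ) ⊗[ℤ] (Fin n → ℤ)) :=
  Submodule.span ℤ {z | ∃ x y : Fin n → ℤ, z = x ⊗ₜ y - y ⊗ₜ x}

/-- The second symmetric power `S²H` of `H = ℤⁿ`: the quotient of `H ⊗ H` by the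
relations `x ⊗ y = y ⊗ x`. -/
abbrev Sym2H (n : ℕ) := ((Fin n → ℤ) ⊗[ℤ] (Fin n → ℤ)) ⧸ symRel n

/-- The symmetric product `x ⊙ y ∈ S²H`. -/
noncomputable def sprod {n : ℕ} (x y : Fin n → ℤ) : Sym2H n :=
  Submodule.Quotient.mk (x ⊗ₜ[ℤ] y)

/-- `ε_{mn}`, the sign of `n - m` for distinct labels `m`, `n`. -/
def eps (m nn : Fin 3) : ℤ := if m < nn then 1 else -1

namespace YDiag

variable {n : ℕ}

section Relations

lemma mk_eq_zero_of_mem_rels {x : FreeAbelianGroup (YGen n)} (hx : x ∈ rels n) :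
    (QuotientAddGroup.mk x : A2 n) = 0 :=
  (QuotientAddGroup.eq_zero_iff x).2 (AddSubgroup.subset_closure hx)

lemma cls_eq_zero {g : YGen n} {p q : Fin 3} (hpq : p ≠ q) (h : g p = g q) : cls g = 0 :=
  mk_eq_zero_of_mem_rels <| .inl <| .inl <| .inl <| .inl <| .inl ⟨g, ⟨p, q, hpq, h⟩, rfl⟩

lemma cls_rotate (g : YGen n) : cls (fun p => g (p + 1)) = cls g :=
  (sub_eq_zero.1 <| mk_eq_zero_of_mem_rels <|
    .inl <| .inl <| .inl <| .inl <| .inr ⟨g, rfl⟩ : cls g = _).symm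

lemma cls_relabel {g g' : YGen n} (hc : ∀ p, color g p = color g' p)
    (hl : ∀ p q, color g p = color g q → (lab g p < lab g q ↔ lab g' p < lab g' q)) :
    cls g = cls g' :=
  sub_eq_zero.1 <| mk_eq_zero_of_mem_rels <| .inl <| .inl <| .inl <| .inr ⟨g, g', hc, hl, rfl⟩

lemma cls_swap_of_ne {g : YGen n} (h01 : color g 0 ≠ color g 1) (h12 : color g 1 ≠ color g 2)
    (h02 : color g 0 ≠ color g 2) : cls (g ∘ Equiv.swap 0 1) = -cls g :=
  eq_neg_of_add_eq_zero_right <| mk_eq_zero_of_mem_rels <|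
    .inl <| .inl <| .inr ⟨g, ⟨h01, h12, h02⟩, rfl⟩

lemma cls_swap_of_eq {g : YGen n} (h : color g 0 = color g 1) (hl : lab g 0 ≠ lab g 1) :
    cls (g ∘ Equiv.swap 0 1) = -cls g :=
  eq_neg_of_add_eq_zero_right <| mk_eq_zero_of_mem_rels <| .inl <| .inr ⟨g, h, hl, rfl⟩

lemma cls_exchange {i j : Fin n} (hij : i ≠ j) (a b l l' : Fin 3) :
    cls ![(i, a), (i, b), (j, l)] = cls ![(j, a), (j, b), (i, l')] :=
  sub_eq_zero.1 <| mk_eq_zero_of_mem_rels <| .inr ⟨i, j, a, b, l, l', hij, rfl⟩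

lemma cls_rotate_vec (x y z : Fin n × Fin 3) : cls ![y, z, x] = cls ![x, y, z] := by
  rw [← cls_rotate ![x, y, z]]
  congr 1
  ext p : 1
  fin_cases p <;> rfl

lemma cls_swap_vec {i : Fin n} {a b : Fin 3} (hab : a ≠ b) (x : Fin n × Fin 3) :
    cls ![(i, b), (i, a), x] = -cls ![(i, a), (i, b), x] := by
  rw [← cls_swap_of_eq (g := ![(i, a), (i, b), x]) rfl hab]
  congr 1
  ext p : 1
  fin_cases p <;> rfl

end Relations

section Forward

/-- The sign of the label of `y` minus the label of `x` when the vertices `x` and `y` share their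
color, and `0` otherwise. -/
def pairSign (x y : Fin n × Fin 3) : ℤ :=
  if x.1 = y.1 then (if x.2 < y.2 then 1 else if y.2 < x.2 then -1 else 0) else 0

lemma pairSign_swap (x y : Fin n × Fin 3) : pairSign y x = -pairSign x y := by
  unfold pairSign
  grind

lemma pairSign_of_ne {x y : Fin n × Fin 3} (h : x.1 ≠ y.1) : pairSign x y = 0 := if_neg h

lemma pairSign_self (x : Fin n × Fin 3) : pairSign x x = 0 := by simp [pairSign]

/-- The standard basis vector of `ℤⁿ`. -/
abbrev stdVec (i : Fin n) : Fin n → ℤ := Pi.single i 1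

lemma sprod_comm (x y : Fin n → ℤ) : sprod x y = sprod y x :=
  (Submodule.Quotient.eq _).2 (Submodule.subset_span ⟨x, y, rfl⟩)

/-- The `S²H`-component of `η` on a Y-diagram, in a form uniform in the coincidences of colors. -/
noncomputable def etaSym (x y z : Fin n × Fin 3) : Sym2H n :=
  pairSign x y • sprod (stdVec x.1) (stdVec z.1) +
    pairSign y z • sprod (stdVec y.1) (stdVec x.1) +
    pairSign z x • sprod (stdVec z.1) (stdVec y.1)

lemma etaSym_rotate (x y z : Fin n × Fin 3) : etaSym y z x = etaSym x y z := by
  unfold etaSym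
  abel

lemma pairSign_smul_congr {M : Type*} [AddCommGroup M] (x y : Fin n × Fin 3) (F : Fin n → M) :
    pairSign x y • F x.1 = pairSign x y • F y.1 := by
  by_cases h : x.1 = y.1
  · rw [h]
  · simp [pairSign_of_ne h]

lemma etaSym_swap (x y z : Fin n × Fin 3) : etaSym y x z = -etaSym x y z := by
  have h₁ := pairSign_smul_congr x y (fun i => sprod (stdVec i) (stdVec z.1))
  have h₂ := pairSign_smul_congr y z (fun i => sprod (stdVec i) (stdVec x.1))
  have h₃ := pairSign_smul_congr z x (fun i => sprod (stdVec i) (stdVec y.1))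
  unfold etaSym
  rw [h₁, h₂, h₃, pairSign_swap x y, pairSign_swap z x, pairSign_swap y z,
    sprod_comm (stdVec x.1) (stdVec y.1)]
  simp only [neg_smul]
  rw [sprod_comm (stdVec z.1) (stdVec x.1)]
  abel

lemma etaSym_self (x z : Fin n × Fin 3) : etaSym x x z = 0 := by
  have h := pairSign_smul_congr z x (fun i => sprod (stdVec i) (stdVec x.1))
  unfold etaSym
  rw [h, pairSign_self, pairSign_swap x z]
  simp

/-- The value of `η` on a Y-diagram. -/
noncomputable def etaGen (g : YGen n) : (⋀[ℤ]^3 (Fin n → ℤ)) × Sym2H n :=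
  (exteriorPower.ιMulti ℤ 3 fun p => stdVec (color g p), etaSym (g 0) (g 1) (g 2))

lemma etaGen_eq_zero {g : YGen n} {p q : Fin 3} (hpq : p ≠ q) (h : g p = g q) :
    etaGen g = 0 := by
  refine Prod.ext (AlternatingMap.map_eq_zero_of_eq _ _ (i := p) (j := q) ?_ hpq) ?_
  · simp [color, h]
  · change etaSym (g 0) (g 1) (g 2) = 0
    obtain h | h | h : g 0 = g 1 ∨ g 1 = g 2 ∨ g 2 = g 0 := by
      fin_cases p <;> fin_cases q <;> simp_all
    · rw [h, etaSym_self]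
    · rw [← etaSym_rotate, h, etaSym_self]
    · rw [etaSym_rotate (g 2), h, etaSym_self]

lemma etaGen_swap (g : YGen n) : etaGen (g ∘ Equiv.swap 0 1) = -etaGen g :=
  Prod.ext
    (AlternatingMap.map_swap (exteriorPower.ιMulti ℤ 3) (fun p => stdVec (color g p)) (by decide))
    (etaSym_swap (g 0) (g 1) (g 2))

lemma etaGen_rotate (g : YGen n) : etaGen (fun p => g (p + 1)) = etaGen g := by
  refine Prod.ext ?_ (etaSym_rotate (g 0) (g 1) (g 2))
  have h := AlternatingMap.map_perm (exteriorPower.ιMulti ℤ 3) (fun p => stdVec (color g p))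
    (finRotate 3)
  rw [sign_finRotate] at h
  simpa [etaGen, Function.comp_def, finRotate_apply, color] using h

lemma etaGen_relabel {g g' : YGen n} (hc : ∀ p, color g p = color g' p)
    (hl : ∀ p q, color g p = color g q → (lab g p < lab g q ↔ lab g' p < lab g' q)) :
    etaGen g = etaGen g' := by
  have hs (p q : Fin 3) : pairSign (g p) (g q) = pairSign (g' p) (g' q) := by
    have h₁ := hl p q
    have h₂ := hl q p
    have h₃ := hc p
    have h₄ := hc q
    simp only [color, lab] at h₁ h₂ h₃ h₄
    unfold pairSign
    grind
  refine Prod.ext (by simp only [etaGen, hc]) ?_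
  simp only [color] at hc
  simp only [etaGen, etaSym, hs, hc]

lemma etaGen_of_two {i j : Fin n} (hij : i ≠ j) (a b l : Fin 3) :
    etaGen ![(i, a), (i, b), (j, l)] =
      (0, pairSign (i, a) (i, b) • sprod (stdVec i) (stdVec j)) := by
  refine Prod.ext
    (AlternatingMap.map_eq_zero_of_eq _ _ (i := 0) (j := 1) (by simp [color]) (by decide)) ?_
  simp [etaGen, etaSym, pairSign_of_ne (x := (i, b)) (y := (j, l)) hij,
    pairSign_of_ne (x := (j, l)) (y := (i, a)) hij.symm]

lemma etaGen_exchange {i j : Fin n} (hij : i ≠ j) (a b l l' : Fin 3) :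
    etaGen ![(i, a), (i, b), (j, l)] = etaGen ![(j, a), (j, b), (i, l')] := by
  rw [etaGen_of_two hij, etaGen_of_two hij.symm, sprod_comm]
  simp [pairSign]

lemma etaGen_of_one (i : Fin n) (a b c : Fin 3) :
    etaGen ![(i, a), (i, b), (i, c)] =
      (0, (pairSign (i, a) (i, b) + pairSign (i, b) (i, c) + pairSign (i, c) (i, a)) •
        sprod (stdVec i) (stdVec i)) := by
  refine Prod.ext
    (AlternatingMap.map_eq_zero_of_eq _ _ (i := 0) (j := 1) (by simp [color]) (by decide)) ?_
  simp [etaGen, etaSym, add_smul]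

lemma etaGen_of_three {g : YGen n} (hg : Function.Injective (color g)) : (etaGen g).2 = 0 := by
  have h (p q : Fin 3) (hpq : p ≠ q) : pairSign (g p) (g q) = 0 :=
    pairSign_of_ne (hg.ne hpq)
  simp [etaGen, etaSym, h 0 1 (by decide), h 1 2 (by decide), h 2 0 (by decide)]

lemma sign_perm_fin_three : ∀ σ : Equiv.Perm (Fin 3),
    (((if σ 0 < σ 1 then 1 else if σ 1 < σ 0 then -1 else 0) +
      if σ 1 < σ 2 then 1 else if σ 2 < σ 1 then -1 else 0) +
      if σ 2 < σ 0 then 1 else if σ 0 < σ 2 then -1 else 0) =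
    ((Equiv.Perm.sign σ : ℤˣ) : ℤ) := by
  decide

/-- The homomorphism `η : A₂(n) → Λ³H ⊕ S²H`. -/
noncomputable def eta (n : ℕ) : A2 n →+ (⋀[ℤ]^3 (Fin n → ℤ)) × Sym2H n :=
  QuotientAddGroup.lift _ (FreeAbelianGroup.lift etaGen) <| by
    rw [AddSubgroup.closure_le]
    rintro x (((((⟨g, ⟨p, q, hpq, h⟩, rfl⟩ | ⟨g, rfl⟩) | ⟨g, g', hc, hl, rfl⟩) |
      ⟨g, -, rfl⟩) | ⟨g, -, -, rfl⟩) | ⟨i, j, a, b, l, l', hij, rfl⟩)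
    · simpa using etaGen_eq_zero hpq h
    · simpa [sub_eq_zero] using (etaGen_rotate g).symm
    · simpa [sub_eq_zero] using etaGen_relabel hc hl
    · simp [etaGen_swap]
    · simp [etaGen_swap]
    · simpa [sub_eq_zero] using etaGen_exchange hij a b l l'

lemma eta_cls (g : YGen n) : eta n (cls g) = etaGen g :=
  FreeAbelianGroup.lift_apply_of _ _

end Forward

section Backward

/-- The class of the Y-diagram with pairwise distinct colors `c`, extended by zero. -/
noncomputable def triColor (c : Fin 3 → Fin n) : A2 n :=
  open Classical in if Function.Injective c then cls fun p => (c p, p) else 0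

lemma cls_eq_triColor {g : YGen n} (hg : Function.Injective (color g)) :
    cls g = triColor (color g) := by
  rw [triColor, if_pos hg]
  refine cls_relabel (fun p => rfl) fun p q h => ?_
  simp [hg h]

lemma triColor_of_not_injective {c : Fin 3 → Fin n} (hc : ¬ Function.Injective c) :
    triColor c = 0 := if_neg hc

lemma triColor_rotate (c : Fin 3 → Fin n) : triColor (c ∘ finRotate 3) = triColor c := by
  by_cases hc : Function.Injective c
  · have h₁ : Function.Injective (color fun p => ((c p, p) : Fin n × Fin 3)) := hc
    have h₂ : Function.Injective
        (color fun p => ((c (p + 1), p + 1) : Fin n × Fin 3)) :=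
      hc.comp (add_left_injective 1)
    have := cls_rotate fun p => ((c p, p) : Fin n × Fin 3)
    rw [cls_eq_triColor h₁, cls_eq_triColor h₂] at this
    have hc' : c ∘ finRotate 3 = fun p => c (p + 1) :=
      funext fun p => congrArg c (finRotate_apply p)
    rw [hc']
    exact this
  · rw [triColor_of_not_injective hc, triColor_of_not_injective]
    simpa using hc

lemma triColor_swap_zero_one (c : Fin 3 → Fin n) :
    triColor (c ∘ Equiv.swap 0 1) = -triColor c := by
  by_cases hc : Function.Injective c
  · have h₁ : Function.Injective (color fun p => ((c p, p) : Fin n × Fin 3)) := hc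
    have h₂ : Function.Injective
        (color ((fun p => ((c p, p) : Fin n × Fin 3)) ∘ Equiv.swap 0 1)) :=
      hc.comp (Equiv.swap 0 1).injective
    have := cls_swap_of_ne (h₁.ne (by decide : (0 : Fin 3) ≠ 1))
      (h₁.ne (by decide : (1 : Fin 3) ≠ 2)) (h₁.ne (by decide : (0 : Fin 3) ≠ 2))
    rwa [cls_eq_triColor h₁, cls_eq_triColor h₂] at this
  · rw [triColor_of_not_injective hc, triColor_of_not_injective, neg_zero]
    simpa using hc

lemma triColor_swap (c : Fin 3 → Fin n) {p q : Fin 3} (hpq : p ≠ q) :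
    triColor (c ∘ Equiv.swap p q) = -triColor c := by
  obtain ⟨k, hk⟩ : ∃ k : ℕ, Equiv.swap p q = finRotate 3 ^ k * Equiv.swap 0 1 := by
    suffices ∃ k : Fin 3, Equiv.swap p q = finRotate 3 ^ (k : ℕ) * Equiv.swap 0 1 from
      ⟨_, this.choose_spec⟩
    revert p q
    decide
  have hrot (k : ℕ) : triColor (c ∘ ⇑(finRotate 3 ^ k)) = triColor c := by
    induction k with
    | zero => simp
    | succ k ih => rw [pow_succ, Equiv.Perm.coe_mul, ← Function.comp_assoc, triColor_rotate, ih]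
  rw [hk, Equiv.Perm.coe_mul, ← Function.comp_assoc, triColor_swap_zero_one, hrot]

/-- The alternating extension of `triColor`. -/
noncomputable def triColorAlt (n : ℕ) : (Fin n → ℤ) [⋀^Fin 3]→ₗ[ℤ] A2 n :=
  { (∑ c : Fin 3 → Fin n, ((MultilinearMap.mkPiAlgebra ℤ (Fin 3) ℤ).compLinearMap
      fun p => LinearMap.proj (c p)).smulRight (triColor c) :
      MultilinearMap ℤ (fun _ : Fin 3 => Fin n → ℤ) (A2 n)) with
    map_eq_zero_of_eq' := by
      intro v p q hv hpq
      simp only [MultilinearMap.toFun_eq_coe, sum_apply,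
        MultilinearMap.smulRight_apply, MultilinearMap.compLinearMap_apply, LinearMap.proj_apply,
        MultilinearMap.mkPiAlgebra_apply]
      refine Finset.sum_involution (fun c _ => c ∘ Equiv.swap p q) ?_ ?_
        (fun _ _ => Finset.mem_univ _) ?_
      · intro c _
        have hprod : ∏ r, v r ((c ∘ Equiv.swap p q) r) = ∏ r, v r (c r) := by
          rw [← Equiv.prod_comp (Equiv.swap p q) fun r => v r (c r)]
          refine Finset.prod_congr rfl fun r _ => ?_
          have : v (Equiv.swap p q r) = v r := by
            rw [Equiv.swap_apply_def]
            split_ifs with h₁ h₂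
            · rw [h₁, hv]
            · rw [h₂, hv]
            · rfl
          simp [this]
        rw [hprod, triColor_swap c hpq, smul_neg, add_neg_cancel]
      · intro c _ hne hc
        refine hne ?_
        rw [triColor_of_not_injective, smul_zero]
        intro hinj
        have := congrFun hc p
        simp only [Function.comp_apply, Equiv.swap_apply_left] at this
        exact hpq (hinj this).symm
      · intro c _
        ext r
        simp }

lemma triColorAlt_stdVec (c : Fin 3 → Fin n) :
    triColorAlt n (fun p => stdVec (c p)) = triColor c := by
  change (∑ c' : Fin 3 → Fin n, ((MultilinearMap.mkPiAlgebra ℤ (Fin 3) ℤ).compLinearMap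
      fun p => LinearMap.proj (c' p)).smulRight (triColor c') :
      MultilinearMap ℤ (fun _ : Fin 3 => Fin n → ℤ) (A2 n)) _ = _
  simp only [sum_apply,
        MultilinearMap.smulRight_apply, MultilinearMap.compLinearMap_apply, LinearMap.proj_apply,
        MultilinearMap.mkPiAlgebra_apply]
  rw [Finset.sum_eq_single c]
  · simp
  · intro c' _ hc
    obtain ⟨p, hp⟩ := Function.ne_iff.1 hc
    rw [Finset.prod_eq_zero (Finset.mem_univ p) (by simp [hp]), zero_smul]
  · simp

/-- The class of the Y-diagram with two vertices of color `i` and one of color `j`. -/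
def biColor (i j : Fin n) : A2 n := cls ![(i, 0), (i, 1), (j, 2)]

lemma biColor_comm (i j : Fin n) : biColor i j = biColor j i := by
  by_cases h : i = j
  · rw [h]
  · exact cls_exchange h _ _ _ _

/-- The bilinear extension of `biColor`. -/
noncomputable def biColorBilin (n : ℕ) : (Fin n → ℤ) →ₗ[ℤ] (Fin n → ℤ) →ₗ[ℤ] A2 n :=
  (Pi.basisFun ℤ (Fin n)).constr ℤ fun i => (Pi.basisFun ℤ (Fin n)).constr ℤ (biColor i)

lemma biColorBilin_stdVec (i j : Fin n) :
    biColorBilin n (stdVec i) (stdVec j) = biColor i j := by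
  rw [stdVec, stdVec, ← Pi.basisFun_apply, ← Pi.basisFun_apply, biColorBilin,
    Module.Basis.constr_basis, Module.Basis.constr_basis]

lemma biColorBilin_comm (x y : Fin n → ℤ) : biColorBilin n x y = biColorBilin n y x := by
  suffices biColorBilin n = (biColorBilin n).flip from LinearMap.congr_fun₂ this x y
  refine LinearMap.ext_basis (Pi.basisFun ℤ (Fin n)) (Pi.basisFun ℤ (Fin n)) fun i j => ?_
  simp only [Pi.basisFun_apply, LinearMap.flip_apply, biColorBilin_stdVec]
  exact biColor_comm i j

/-- The homomorphism `S²H → A₂(n)` induced by `biColor`. -/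
noncomputable def symInv (n : ℕ) : Sym2H n →ₗ[ℤ] A2 n :=
  (symRel n).liftQ (TensorProduct.lift (biColorBilin n)) <| by
    rw [symRel, Submodule.span_le]
    rintro _ ⟨x, y, rfl⟩
    change TensorProduct.lift (biColorBilin n) (x ⊗ₜ y - y ⊗ₜ x) = 0
    rw [map_sub, TensorProduct.lift.tmul, TensorProduct.lift.tmul, biColorBilin_comm x y, sub_self]

lemma symInv_sprod (i j : Fin n) : symInv n (sprod (stdVec i) (stdVec j)) = biColor i j :=
  biColorBilin_stdVec i j

/-- The inverse of `η`. -/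
noncomputable def etaInv (n : ℕ) : (⋀[ℤ]^3 (Fin n → ℤ)) × Sym2H n →ₗ[ℤ] A2 n :=
  (exteriorPower.alternatingMapLinearEquiv (triColorAlt n)).coprod (symInv n)

lemma etaInv_etaGen_of_two {i j : Fin n} (hij : i ≠ j) (a b l : Fin 3) :
    etaInv n (etaGen ![(i, a), (i, b), (j, l)]) = cls ![(i, a), (i, b), (j, l)] := by
  have key {a b : Fin 3} (hab : a < b) : cls ![(i, a), (i, b), (j, l)] = biColor i j := by
    refine cls_relabel (fun p => by fin_cases p <;> rfl) fun p q => ?_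
    fin_cases p <;> fin_cases q <;> simp [color, lab, hij, hij.symm, hab, hab.le]
  rw [etaGen_of_two hij, etaInv, LinearMap.coprod_apply, map_zero, zero_add, map_smul,
    symInv_sprod]
  obtain hab | rfl | hab := lt_trichotomy a b
  · simp [pairSign, hab, key hab]
  · rw [cls_eq_zero (p := 0) (q := 1) (by decide) rfl, pairSign_self, zero_smul]
  · rw [cls_swap_vec hab.ne, key hab]
    simp [pairSign, hab, hab.not_gt]

lemma etaInv_etaGen_of_one (i : Fin n) (a b c : Fin 3) :
    etaInv n (etaGen ![(i, a), (i, b), (i, c)]) = cls ![(i, a), (i, b), (i, c)] := by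
  rw [etaGen_of_one, etaInv, LinearMap.coprod_apply, map_zero, zero_add, map_smul, symInv_sprod]
  have h₁ : cls ![(i, 1), (i, 2), (i, 0)] = biColor i i := cls_rotate_vec _ _ _
  have h₂ : cls ![(i, 2), (i, 0), (i, 1)] = biColor i i := (cls_rotate_vec _ _ _).trans h₁
  have h₃ : cls ![(i, 1), (i, 0), (i, 2)] = -biColor i i := cls_swap_vec (by decide) _
  have h₄ : cls ![(i, 2), (i, 1), (i, 0)] = -biColor i i :=
    h₁ ▸ cls_swap_vec (by decide) _
  have h₅ : cls ![(i, 0), (i, 2), (i, 1)] = -biColor i i :=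
    h₂ ▸ cls_swap_vec (by decide) _
  by_cases hab : a = b
  · rw [cls_eq_zero (p := 0) (q := 1) (by decide) (by simp [hab]), hab, pairSign_self,
      pairSign_swap (i, b) (i, c)]
    simp
  by_cases hbc : b = c
  · rw [cls_eq_zero (p := 1) (q := 2) (by decide) (by simp [hbc]), hbc, pairSign_self,
      pairSign_swap (i, a) (i, c)]
    simp
  by_cases hca : c = a
  · rw [cls_eq_zero (p := 0) (q := 2) (by decide) (by simp [hca]), hca, pairSign_self,
      pairSign_swap (i, a) (i, b)]
    simp
  fin_cases a <;> fin_cases b <;> fin_cases c <;>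
    first
    | exact absurd rfl hab
    | exact absurd rfl hbc
    | exact absurd rfl hca
    | simp [pairSign, biColor, h₁, h₂, h₃, h₄, h₅]

lemma etaInv_etaGen_of_color_eq {g : YGen n} (h : color g 0 = color g 1) :
    etaInv n (etaGen g) = cls g := by
  obtain ⟨i, j, a, b, l, rfl⟩ : ∃ i j a b l, g = ![(i, a), (i, b), (j, l)] := by
    refine ⟨color g 0, color g 2, lab g 0, lab g 1, lab g 2, ?_⟩
    ext p : 1
    fin_cases p
    · rfl
    · exact Prod.ext h.symm rfl
    · rfl
  by_cases hij : i = j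
  · subst hij
    exact etaInv_etaGen_of_one i a b l
  · exact etaInv_etaGen_of_two hij a b l

lemma etaInv_etaGen (g : YGen n) : etaInv n (etaGen g) = cls g := by
  by_cases hg : Function.Injective (color g)
  · rw [cls_eq_triColor hg, etaInv, LinearMap.coprod_apply, etaGen_of_three hg, map_zero,
      add_zero, etaGen, exteriorPower.alternatingMapLinearEquiv_apply_ιMulti, triColorAlt_stdVec]
  · obtain h | h | h : color g 0 = color g 1 ∨ color g 1 = color g 2 ∨ color g 2 = color g 0 := by
      contrapose! hg
      intro p q hpq
      fin_cases p <;> fin_cases q <;> simp_all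
    · exact etaInv_etaGen_of_color_eq h
    · rw [← etaGen_rotate, ← cls_rotate]
      exact etaInv_etaGen_of_color_eq h
    · rw [← etaGen_rotate, ← cls_rotate, ← etaGen_rotate, ← cls_rotate]
      exact etaInv_etaGen_of_color_eq h

lemma etaInv_eta (x : A2 n) : etaInv n (eta n x) = x := by
  suffices ((etaInv n).toAddMonoidHom.comp (eta n)) = AddMonoidHom.id _ from
    DFunLike.congr_fun this x
  refine QuotientAddGroup.addMonoidHom_ext _ (FreeAbelianGroup.lift_ext _ _ fun g => ?_)
  exact (congrArg _ (eta_cls g)).trans (etaInv_etaGen g)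

lemma eta_biColor (i j : Fin n) :
    eta n (biColor i j) = (0, sprod (stdVec i) (stdVec j)) := by
  rw [biColor, eta_cls]
  by_cases h : i = j
  · subst h
    rw [etaGen_of_one]
    simp [pairSign]
  · rw [etaGen_of_two h]
    simp [pairSign]

lemma eta_comp_etaInv :
    (eta n).toIntLinearMap ∘ₗ etaInv n = LinearMap.id := by
  refine LinearMap.prod_ext ?_ ?_
  · refine exteriorPower.linearMap_ext <|
      Module.Basis.ext_alternating (Pi.basisFun ℤ (Fin n)) fun c hc => ?_
    simp only [Pi.basisFun_apply, LinearMap.compAlternatingMap_apply, LinearMap.comp_apply,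
      LinearMap.inl_apply, etaInv, LinearMap.coprod_apply, map_zero, add_zero,
      exteriorPower.alternatingMapLinearEquiv_apply_ιMulti, triColorAlt_stdVec,
      AddMonoidHom.coe_toIntLinearMap, LinearMap.id_apply]
    rw [triColor, if_pos hc, eta_cls]
    exact Prod.ext rfl (etaGen_of_three hc)
  · refine Submodule.linearMap_qext _ <| TensorProduct.ext <|
      LinearMap.ext_basis (Pi.basisFun ℤ (Fin n)) (Pi.basisFun ℤ (Fin n)) fun i j => ?_
    change eta n (etaInv n (0, sprod _ _)) = (0, sprod _ _)
    rw [Pi.basisFun_apply, Pi.basisFun_apply, etaInv, LinearMap.coprod_apply, map_zero, zero_add,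
      symInv_sprod, eta_biColor]

lemma eta_bijective : Function.Bijective (eta n) :=
  Function.bijective_iff_has_inverse.2
    ⟨etaInv n, etaInv_eta, fun x => DFunLike.congr_fun eta_comp_etaInv x⟩

end Backward

end YDiag

open YDiag in
/-- The map `η : A₂(n) → Λ³H ⊕ S²H` (with `H = ℤⁿ`) determined on generators by
`η(Y[i;j;k]) = e_i ∧ e_j ∧ e_k` for pairwise distinct colors, by
`η(Y[(i,m);(i,n);j]) = ε_{mn}·(e_i ⊙ e_j)` for `i ≠ j` and `m ≠ n`, and by
`η(Y[(i,σ(1));(i,σ(2));(i,σ(3))]) = sgn(σ)·(e_i ⊙ e_i)` for a permutation `σ` of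
the labels, is a well-defined isomorphism of abelian groups. -/
theorem A2_eta_iso (n : ℕ) (hn : 1 ≤ n) :
    ∃ f : A2 n →+ (⋀[ℤ]^3 (Fin n → ℤ)) × Sym2H n,
      (∀ (i j k : Fin n) (a b c : Fin 3), i ≠ j → j ≠ k → i ≠ k →
        ((f (cls ![(i, a), (j, b), (k, c)])).1 : ExteriorAlgebra ℤ (Fin n → ℤ)) =
            ExteriorAlgebra.ιMulti ℤ 3
              ![Pi.single i (1 : ℤ), Pi.single j (1 : ℤ), Pi.single k (1 : ℤ)] ∧
          (f (cls ![(i, a), (j, b), (k, c)])).2 = 0) ∧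
      (∀ (i j : Fin n) (m nn l : Fin 3), i ≠ j → m ≠ nn →
        f (cls ![(i, m), (i, nn), (j, l)]) =
          (0, eps m nn • sprod (Pi.single i (1 : ℤ)) (Pi.single j (1 : ℤ)))) ∧
      (∀ (i : Fin n) (σ : Equiv.Perm (Fin 3)),
        f (cls ![(i, σ 0), (i, σ 1), (i, σ 2)]) =
          (0, ((Equiv.Perm.sign σ : ℤˣ) : ℤ) •
            sprod (Pi.single i (1 : ℤ)) (Pi.single i (1 : ℤ)))) ∧
      Function.Bijective f := by
  refine ⟨eta n, fun i j k a b c hij hjk hik => ?_, fun i j a b l hij hab => ?_, fun i σ => ?_,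
    eta_bijective⟩
  · rw [eta_cls]
    refine ⟨?_, etaGen_of_three ?_⟩
    · rw [etaGen, exteriorPower.ιMulti_apply_coe]
      congr 1
      ext p : 1
      fin_cases p <;> rfl
    · intro p q hpq
      fin_cases p <;> fin_cases q <;> simp_all [color]
  · rw [eta_cls, etaGen_of_two hij]
    congr 2
    unfold pairSign eps
    grind
  · rw [eta_cls, etaGen_of_one]
    congr 2
    simpa [pairSign] using sign_perm_fin_three σ
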